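/- arXiv:1406.1582 — 10 statements merged into one kernel-verified Lean document; each statement's English description precedes it below -/
import Mathlib

section
/- IEL ⊢ ¬K⊥ (provable consistency of knowledge). -/
/-- Formulas of intuitionistic epistemic logic: atoms, ⊥, ∧, ∨, →, and the
epistemic operator `K`. `¬A` abbreviates `A → ⊥`. -/
inductive Formula : Type
  | atom : ℕ → Formula
  | bot  : Formula
  | and  : Formula → Formula → Formula
  | or   : Formula → Formula → Formula
  | imp  : Formula → Formula → Formula
  | K    : Formula → Formula

namespace Formula
def neg (A : Formula) : Formula := A.imp bot
def iff (A B : Formula) : Formula := (A.imp B).and (B.imp A)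
end Formula

open Formula

/-- Hilbert-style derivability. `Deriv false` is IEL⁻ (intuitionistic
propositional axioms, distribution `K(A→B) → (KA→KB)`, co-reflection `A → KA`,
modus ponens); `Deriv true` is IEL, which additionally has intuitionistic
reflection `KA → ¬¬A`. -/
inductive Deriv : Bool → Formula → Prop
  | a1 {b : Bool} {A B : Formula} : Deriv b (A.imp (B.imp A))
  | a2 {b : Bool} {A B C : Formula} :
      Deriv b ((A.imp (B.imp C)).imp ((A.imp B).imp (A.imp C)))
  | a3 {b : Bool} {A B : Formula} : Deriv b ((A.and B).imp A)
  | a4 {b : Bool} {A B : Formula} : Deriv b ((A.and B).imp B)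
  | a5 {b : Bool} {A B : Formula} : Deriv b (A.imp (B.imp (A.and B)))
  | a6 {b : Bool} {A B : Formula} : Deriv b (A.imp (A.or B))
  | a7 {b : Bool} {A B : Formula} : Deriv b (B.imp (A.or B))
  | a8 {b : Bool} {A B C : Formula} :
      Deriv b ((A.imp C).imp ((B.imp C).imp ((A.or B).imp C)))
  | a9 {b : Bool} {A : Formula} : Deriv b (Formula.bot.imp A)
  | dist {b : Bool} {A B : Formula} :
      Deriv b ((K (A.imp B)).imp ((K A).imp (K B)))
  | coref {b : Bool} {A : Formula} : Deriv b (A.imp (K A))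
  | ir {A : Formula} : Deriv true ((K A).imp A.neg.neg)
  | mp {b : Bool} {A B : Formula} : Deriv b (A.imp B) → Deriv b A → Deriv b B

theorem not_K_bot : Deriv true (K Formula.bot).neg := by
  exact .mp (.mp .a2 .ir) (.mp .a1 .a9)
end

section
/- For every formula A, IEL ⊢ ¬(K A ∧ ¬A). -/
open Formula

/-- Derivable implications compose. -/
theorem Deriv.imp_trans {b : Bool} {A B C : Formula}
    (hAB : Deriv b (A.imp B)) (hBC : Deriv b (B.imp C)) : Deriv b (A.imp C) :=
  .mp (.mp .a2 (.mp .a1 hBC)) hAB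

theorem not_K_and_not : ∀ A : Formula, Deriv true ((K A).and A.neg).neg := by
  intro A
  exact .mp (.mp .a2 (Deriv.a3.imp_trans .ir)) .a4
end

section
/- For every formula A, IEL ⊢ ¬¬(K A → A) (the double negation of classical reflection is intuitionistically derivable). -/
open Formula

namespace Deriv

variable {b : Bool} {A B C : Formula}

theorem imp_self : Deriv b (A.imp A) :=
  mp (mp a2 a1) (a1 (B := A))

theorem imp_mp (h : Deriv b (A.imp (B.imp C))) (h' : Deriv b (A.imp B)) : Deriv b (A.imp C) :=
  mp (mp a2 h) h'

theorem imp_trans_s5 (h : Deriv b (A.imp B)) (h' : Deriv b (B.imp C)) : Deriv b (A.imp C) :=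
  imp_mp (mp a1 h') h

theorem imp_swap (h : Deriv b (A.imp (B.imp C))) : Deriv b (B.imp (A.imp C)) :=
  imp_trans_s5 a1 (mp a2 h)

theorem neg_mono (h : Deriv b (A.imp B)) : Deriv b (B.neg.imp A.neg) :=
  mp (imp_swap (imp_trans_s5 a1 a2)) h

theorem neg_imp_imp : Deriv b (A.neg.imp (A.imp B)) :=
  mp a2 (mp a1 a9)

theorem neg_imp_neg_K : Deriv true (A.neg.imp (K A).neg) :=
  imp_swap ir

end Deriv

theorem dn_reflection : ∀ A : Formula, Deriv true ((K A).imp A).neg.neg := by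
  intro A
  have h : Deriv true (((K A).imp A).neg.imp ((K A).imp A)) :=
    ((Deriv.neg_mono Deriv.a1).imp_trans_s5 Deriv.neg_imp_neg_K).imp_trans_s5 Deriv.neg_imp_imp
  exact Deriv.imp_mp Deriv.imp_self h
end

section
/- Soundness: for L ∈ {IEL⁻, IEL}, if L ⊢ A then A holds at every world of every L-model. -/
open Formula

/-- An IEL⁻-model: a nonempty partial order `(W,R)`, a monotone valuation of
propositional letters, and an `E` relation with `E(u) ⊆ R(u)` and
`u R v → E(v) ⊆ E(u)`. -/
structure KModel where
  W : Type
  ne : Nonempty W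
  R : W → W → Prop
  refl : ∀ u, R u u
  trans : ∀ {u v w}, R u v → R v w → R u w
  antisymm : ∀ {u v}, R u v → R v u → u = v
  val : W → ℕ → Prop
  mono : ∀ {u v : W} {n : ℕ}, R u v → val u n → val v n
  E : W → W → Prop
  E_sub_R : ∀ {u v}, E u v → R u v
  E_mono : ∀ {u v w}, R u v → E v w → E u w

/-- Forcing relation: the usual intuitionistic Kripke clauses, with
`u ⊩ K A` iff `v ⊩ A` for all `v ∈ E(u)`. -/
def force (M : KModel) : M.W → Formula → Prop
  | u, .atom n => M.val u n
  | _, .bot => False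
  | u, .and A B => force M u A ∧ force M u B
  | u, .or A B => force M u A ∨ force M u B
  | u, .imp A B => ∀ v, M.R u v → force M v A → force M v B
  | u, .K A => ∀ v, M.E u v → force M v A

/-- An IEL-model is an IEL⁻-model in which `E(u) ≠ ∅` for every `u`. -/
def KModel.serial (M : KModel) : Prop := ∀ u : M.W, ∃ v : M.W, M.E u v

/-- Forcing persists along the accessibility relation. -/
theorem force_mono (M : KModel) {u v : M.W} (A : Formula) (huv : M.R u v)
    (h : force M u A) : force M v A := by
  induction A with
  | atom n => exact M.mono huv h
  | bot => exact h
  | and A B ihA ihB => exact ⟨ihA h.1, ihB h.2⟩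
  | or A B ihA ihB => exact h.imp ihA ihB
  | imp A B => exact fun w hvw => h w (M.trans huv hvw)
  | K A => exact fun w hvw => h w (M.E_mono huv hvw)

/-- Soundness for both systems at once; seriality is only needed for reflection. -/
theorem Deriv.force {b : Bool} {A : Formula} (hA : Deriv b A) (M : KModel)
    (hM : b = true → M.serial) : ∀ u : M.W, _root_.force M u A := by
  induction hA with
  | a1 => exact fun _ _ _ hA _ hvw _ => force_mono M _ hvw hA
  | a2 =>
    exact fun _ _ _ hABC w hvw hAB x hwx hA =>
      hABC x (M.trans hvw hwx) hA x (M.refl x) (hAB x hwx hA)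
  | a3 => exact fun _ _ _ h => h.1
  | a4 => exact fun _ _ _ h => h.2
  | a5 => exact fun _ _ _ hA _ hvw hB => ⟨force_mono M _ hvw hA, hB⟩
  | a6 => exact fun _ _ _ h => Or.inl h
  | a7 => exact fun _ _ _ h => Or.inr h
  | a8 =>
    exact fun _ _ _ hAC w hvw hBC x hwx h =>
      h.elim (hAC x (M.trans hvw hwx)) (hBC x hwx)
  | a9 => exact fun _ _ _ h => False.elim h
  | dist =>
    exact fun _ _ _ hAB w hvw hA x hwx =>
      hAB x (M.E_mono hvw hwx) x (M.refl x) (hA x hwx)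
  | coref => exact fun _ _ _ hA _ hvw => force_mono M _ (M.E_sub_R hvw) hA
  | ir =>
    intro u v _ hKA w hvw hnA
    obtain ⟨x, hwx⟩ := hM rfl w
    exact hnA x (M.E_sub_R hwx) (hKA x (M.E_mono hvw hwx))
  | mp _ _ ihAB ihA => exact fun u => ihAB hM u u (M.refl u) (ihA hM u)

theorem soundness :
    (∀ A : Formula, Deriv false A → ∀ (M : KModel) (u : M.W), force M u A) ∧
    (∀ A : Formula, Deriv true A →
      ∀ M : KModel, M.serial → ∀ u : M.W, force M u A) := by
  exact ⟨fun _ hA M => hA.force M (by simp), fun _ hA M hM => hA.force M fun _ => hM⟩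
end

section
/- IEL⁻ is a strict subset of IEL: every theorem of IEL⁻ is a theorem of IEL, but there is a formula (e.g. the intuitionistic reflection axiom K A → ¬¬A for a propositional letter A) derivable in IEL and not derivable in IEL⁻. -/
open Formula

/-- Classical truth when every atom is false and every formula `K A` is true. -/
def allKnownEval : Formula → Prop
  | .atom _ => False
  | .bot => False
  | .and A B => allKnownEval A ∧ allKnownEval B
  | .or A B => allKnownEval A ∨ allKnownEval B
  | .imp A B => allKnownEval A → allKnownEval B
  | .K _ => True

theorem Deriv.allKnownEval {A : Formula} (h : Deriv false A) : allKnownEval A := by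
  generalize hb : false = b at h
  induction h with
  | ir => cases hb
  | mp _ _ ih₁ ih₂ => exact ih₁ hb (ih₂ hb)
  | _ => simp only [_root_.allKnownEval]; tauto

theorem Deriv.of_false {A : Formula} (h : Deriv false A) : Deriv true A := by
  generalize hb : false = b at h
  induction h with
  | ir => exact .ir
  | mp _ _ ih₁ ih₂ => exact .mp (ih₁ hb) (ih₂ hb)
  | _ => constructor

theorem ielm_strict_subset_iel :
    (∀ A : Formula, Deriv false A → Deriv true A) ∧
    Deriv true ((K (Formula.atom 0)).imp (Formula.atom 0).neg.neg) ∧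
    ¬ Deriv false ((K (Formula.atom 0)).imp (Formula.atom 0).neg.neg) := by
  refine ⟨fun _ => Deriv.of_false, .ir, fun h => ?_⟩
  exact h.allKnownEval trivial id
end

section
/- Completeness: for L ∈ {IEL⁻, IEL}, if a formula A holds at every world of every L-model, then L ⊢ A. -/
open Formula

/-- A set of formulas containing all theorems and closed under modus ponens. -/
structure IsTheory (b : Bool) (T : Set Formula) : Prop where
  deriv : ∀ {A}, Deriv b A → A ∈ T
  mp : ∀ {A B}, A.imp B ∈ T → A ∈ T → B ∈ T

/-- A consistent theory with the disjunction property. -/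
structure IsPrimeTheory (b : Bool) (T : Set Formula) : Prop extends IsTheory b T where
  bot_notMem : Formula.bot ∉ T
  or_mem : ∀ {A B}, A.or B ∈ T → A ∈ T ∨ B ∈ T

theorem isTheory_deriv (b : Bool) : IsTheory b {A | Deriv b A} where
  deriv h := h
  mp h h' := Deriv.mp h h'

namespace IsTheory

variable {b : Bool} {T : Set Formula} {A B : Formula}

/-- The deductive closure of `T ∪ {B}`, described by the deduction theorem. -/
theorem adjoin (hT : IsTheory b T) (B : Formula) : IsTheory b {C | B.imp C ∈ T} where
  deriv h := hT.mp (hT.deriv Deriv.a1) (hT.deriv h)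
  mp h h' := hT.mp (hT.mp (hT.deriv Deriv.a2) h) h'

theorem subset_adjoin (hT : IsTheory b T) (B : Formula) : T ⊆ {C | B.imp C ∈ T} :=
  fun _ h => hT.mp (hT.deriv Deriv.a1) h

theorem imp_self_mem (hT : IsTheory b T) (B : Formula) : B.imp B ∈ T :=
  hT.mp (hT.mp (hT.deriv Deriv.a2) (hT.deriv Deriv.a1))
    (hT.deriv (Deriv.a1 (A := B) (B := B)))

theorem known (hT : IsTheory b T) : IsTheory b {A | Formula.K A ∈ T} where
  deriv h := hT.mp (hT.deriv Deriv.coref) (hT.deriv h)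
  mp h h' := hT.mp (hT.mp (hT.deriv Deriv.dist) h) h'

theorem sUnion_of_isChain {c : Set (Set Formula)} (hc : IsChain (· ⊆ ·) c) (hne : c.Nonempty)
    (h : ∀ T ∈ c, IsTheory b T) : IsTheory b (⋃₀ c) where
  deriv hA := by
    obtain ⟨T, hT⟩ := hne
    exact ⟨T, hT, (h T hT).deriv hA⟩
  mp := by
    rintro A B ⟨S, hS, hAB⟩ ⟨T, hT, hA⟩
    rcases hc.total hS hT with hST | hTS
    · exact ⟨T, hT, (h T hT).mp (hST hAB) hA⟩
    · exact ⟨S, hS, (h S hS).mp hAB (hTS hA)⟩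

/-- Every theory omitting `A` extends to a prime theory omitting `A`. -/
theorem exists_isPrimeTheory (hT : IsTheory b T) (hA : A ∉ T) :
    ∃ P, IsPrimeTheory b P ∧ T ⊆ P ∧ A ∉ P := by
  obtain ⟨P, hTP, hP⟩ := zorn_subset_nonempty {S | IsTheory b S ∧ A ∉ S}
    (fun c hcS hc hne =>
      ⟨⋃₀ c, ⟨sUnion_of_isChain hc hne fun S hS => (hcS hS).1,
        fun ⟨S, hS, hAS⟩ => (hcS hS).2 hAS⟩, fun S hS => Set.subset_sUnion_of_mem hS⟩)
    T ⟨hT, hA⟩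
  obtain ⟨hPT, hAP⟩ := hP.prop
  have key : ∀ {B}, B ∉ P → B.imp A ∈ P := by
    intro B hB
    by_contra hBA
    exact hB (hP.le_of_ge (y := {C | B.imp C ∈ P}) ⟨hPT.adjoin B, hBA⟩
      (hPT.subset_adjoin B) (hPT.imp_self_mem B))
  refine ⟨P, { hPT with bot_notMem := ?_, or_mem := ?_ }, hTP, hAP⟩
  · exact fun h => hAP (hPT.mp (hPT.deriv Deriv.a9) h)
  · intro B C hBC
    by_contra! h
    exact hAP (hPT.mp (hPT.mp (hPT.mp (hPT.deriv Deriv.a8) (key h.1)) (key h.2)) hBC)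

end IsTheory

/-- The canonical model: prime theories ordered by inclusion, where `E u v` holds when `v`
contains everything known in `u`. -/
def canonicalModel (b : Bool) (h : Nonempty {T : Set Formula // IsPrimeTheory b T}) : KModel where
  W := {T : Set Formula // IsPrimeTheory b T}
  ne := h
  R u v := u.1 ⊆ v.1
  refl _ := subset_rfl
  trans h h' := h.trans h'
  antisymm h h' := Subtype.ext (h.antisymm h')
  val u n := Formula.atom n ∈ u.1
  mono h h' := h h'
  E u v := {A | Formula.K A ∈ u.1} ⊆ v.1
  E_sub_R {u _} h _ hA := h (u.2.mp (u.2.deriv Deriv.coref) hA)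
  E_mono huv hvw _ hA := hvw (huv hA)

/-- The truth lemma. -/
theorem force_canonicalModel_iff {b : Bool} (h : Nonempty {T : Set Formula // IsPrimeTheory b T})
    (A : Formula) (u : {T : Set Formula // IsPrimeTheory b T}) :
    force (canonicalModel b h) u A ↔ A ∈ u.1 := by
  induction A generalizing u with
  | atom n => exact Iff.rfl
  | bot => exact ⟨False.elim, u.2.bot_notMem⟩
  | and A B ihA ihB =>
    refine (and_congr (ihA u) (ihB u)).trans ⟨fun ⟨hA, hB⟩ => ?_, fun hAB => ⟨?_, ?_⟩⟩
    · exact u.2.mp (u.2.mp (u.2.deriv Deriv.a5) hA) hB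
    · exact u.2.mp (u.2.deriv Deriv.a3) hAB
    · exact u.2.mp (u.2.deriv Deriv.a4) hAB
  | or A B ihA ihB =>
    refine (or_congr (ihA u) (ihB u)).trans ⟨?_, u.2.or_mem⟩
    rintro (hA | hB)
    · exact u.2.mp (u.2.deriv Deriv.a6) hA
    · exact u.2.mp (u.2.deriv Deriv.a7) hB
  | imp A B ihA ihB =>
    refine ⟨fun hf => ?_, fun hAB v huv hA =>
      (ihB v).2 (v.2.mp (huv hAB) ((ihA v).1 hA))⟩
    by_contra hAB
    obtain ⟨P, hP, hsub, hB⟩ := (u.2.adjoin A).exists_isPrimeTheory hAB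
    exact hB ((ihB ⟨P, hP⟩).1 (hf ⟨P, hP⟩ ((u.2.subset_adjoin A).trans hsub)
      ((ihA ⟨P, hP⟩).2 (hsub (u.2.imp_self_mem A)))))
  | K A ih =>
    refine ⟨fun hf => ?_, fun hKA v huv => (ih v).2 (huv hKA)⟩
    by_contra hKA
    obtain ⟨P, hP, hsub, hA⟩ := u.2.known.exists_isPrimeTheory hKA
    exact hA ((ih ⟨P, hP⟩).1 (hf ⟨P, hP⟩ hsub))

theorem canonicalModel_serial (h : Nonempty {T : Set Formula // IsPrimeTheory true T}) :
    (canonicalModel true h).serial := by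
  rintro ⟨T, hT⟩
  have hbot : Formula.bot ∉ {A | Formula.K A ∈ T} := fun hK =>
    hT.bot_notMem (hT.mp (hT.mp (hT.deriv Deriv.ir) hK) (hT.imp_self_mem Formula.bot))
  obtain ⟨P, hP, hsub, -⟩ := hT.known.exists_isPrimeTheory hbot
  exact ⟨⟨P, hP⟩, hsub⟩

theorem deriv_of_force_canonicalModel {b : Bool} {A : Formula}
    (hA : ∀ h u, force (canonicalModel b h) u A) : Deriv b A := by
  by_contra hn
  obtain ⟨P, hP, -, hAP⟩ := (isTheory_deriv b).exists_isPrimeTheory hn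
  exact hAP ((force_canonicalModel_iff ⟨⟨P, hP⟩⟩ A ⟨P, hP⟩).1 (hA _ _))

theorem completeness :
    (∀ A : Formula, (∀ (M : KModel) (u : M.W), force M u A) → Deriv false A) ∧
    (∀ A : Formula,
      (∀ M : KModel, M.serial → ∀ u : M.W, force M u A) → Deriv true A) := by
  exact ⟨fun _ hA => deriv_of_force_canonicalModel fun _ u => hA _ u,
    fun _ hA => deriv_of_force_canonicalModel fun h u => hA _ (canonicalModel_serial h) u⟩
end

section
/- Failure of reflection: for L ∈ {IEL⁻, IEL}, there is a formula A (a propositional letter) such that L ⊬ K A → A. -/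
open Formula

/-- The value of a formula in a Heyting algebra, with `K` read as double negation. -/
def Formula.eval {H : Type*} [HeytingAlgebra H] (v : ℕ → H) : Formula → H
  | atom n => v n
  | bot => ⊥
  | and A B => A.eval v ⊓ B.eval v
  | or A B => A.eval v ⊔ B.eval v
  | imp A B => A.eval v ⇨ B.eval v
  | K A => (A.eval v)ᶜᶜ

/-- Soundness of IEL (hence also IEL⁻) for Heyting algebras with `K` read as double negation. -/
theorem Deriv.eval_eq_top {H : Type*} [HeytingAlgebra H] (v : ℕ → H) {b : Bool} {A : Formula}
    (h : Deriv b A) : A.eval v = ⊤ := by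
  induction h with
  | a1 => simp [Formula.eval]
  | @a2 _ A B C =>
    simp only [Formula.eval, himp_eq_top_iff, le_himp_iff]
    generalize A.eval v = x, B.eval v = y, C.eval v = z
    calc (x ⇨ y ⇨ z) ⊓ (x ⇨ y) ⊓ x
        ≤ (y ⇨ z) ⊓ y :=
          le_inf ((inf_le_inf_right x inf_le_left).trans himp_inf_le)
            ((inf_le_inf_right x inf_le_right).trans himp_inf_le)
      _ ≤ z := himp_inf_le
  | a3 => simp [Formula.eval]
  | a4 => simp [Formula.eval]
  | a5 => simp [Formula.eval, le_himp_iff]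
  | a6 => simp [Formula.eval]
  | a7 => simp [Formula.eval]
  | a8 => simp [Formula.eval, le_himp_iff, sup_himp_distrib]
  | a9 => simp [Formula.eval]
  | dist => simp [Formula.eval, compl_compl_himp_distrib]
  | coref => simp [Formula.eval, le_compl_compl]
  | ir => simp [Formula.eval, Formula.neg]
  | mp _ _ ihAB ihA => simpa [Formula.eval, ihA] using ihAB

theorem reflection_fails : ∀ b : Bool, ∃ n : ℕ,
    ¬ Deriv b ((K (Formula.atom n)).imp (Formula.atom n)) := by
  intro b
  refine ⟨0, fun h => ?_⟩
  have h_top := h.eval_eq_top (fun _ => (1 : Fin 3))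
  simp only [Formula.eval] at h_top
  revert h_top
  decide
end

section
/- Knowledge and negation commute: for every formula A, IEL ⊢ ¬K A ↔ K¬A. -/
open Formula

namespace Deriv

theorem imp_trans_s12 {b : Bool} {A B C : Formula} (h₁ : Deriv b (A.imp B))
    (h₂ : Deriv b (B.imp C)) : Deriv b (A.imp C) :=
  mp (mp a2 (mp a1 h₂)) h₁

theorem imp_refl {b : Bool} (A : Formula) : Deriv b (A.imp A) :=
  mp (mp a2 a1) (a1 (B := A))

theorem imp_imp_imp_left {b : Bool} {A B : Formula} (C : Formula)
    (h : Deriv b (A.imp B)) : Deriv b ((B.imp C).imp (A.imp C)) :=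
  mp (mp a2 (imp_trans_s12 a1 a2)) (mp a1 h)

theorem imp_imp_imp_right {b : Bool} {B C : Formula} (A : Formula)
    (h : Deriv b (B.imp C)) : Deriv b ((A.imp B).imp (A.imp C)) :=
  mp a2 (mp a1 h)

theorem neg_K_bot : Deriv true (K bot).neg :=
  mp (mp a2 ir) (mp a1 (imp_refl bot))

theorem neg_K_imp_K_neg {b : Bool} (A : Formula) :
    Deriv b ((K A).neg.imp (K A.neg)) :=
  imp_trans_s12 (imp_imp_imp_left bot coref) coref

theorem K_neg_imp_neg_K (A : Formula) : Deriv true ((K A.neg).imp (K A).neg) :=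
  imp_trans_s12 dist (imp_imp_imp_right (K A) neg_K_bot)

end Deriv

theorem K_neg_commute : ∀ A : Formula,
    Deriv true (Formula.iff (K A).neg (K A.neg)) := by
  intro A
  exact .mp (.mp .a5 (Deriv.neg_K_imp_K_neg A)) (Deriv.K_neg_imp_neg_K A)
end

section
/- Failure of the disjunction distribution under K: for L ∈ {IEL⁻, IEL}, there are formulas A, B (e.g. A = p and B = ¬p for a propositional letter p) such that L ⊬ K(A ∨ B) → (K A ∨ K B). -/
open Formula

/-- The open half-line `(-∞, 0)` refutes weak excluded middle in the open sets of `ℝ`. -/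
theorem exists_opens_compl_compl_sup_compl_ne_top :
    ∃ U : TopologicalSpace.Opens ℝ, Uᶜᶜ ⊔ Uᶜ ≠ ⊤ := by
  let U : TopologicalSpace.Opens ℝ := ⟨Set.Iio 0, isOpen_Iio⟩
  let V : TopologicalSpace.Opens ℝ := ⟨Set.Ioi 0, isOpen_Ioi⟩
  have hVU : V ≤ Uᶜ := by
    rw [le_compl_iff_disjoint_right, disjoint_iff]
    ext x
    simpa [U, V] using fun h : 0 < x => h.le
  have not_mem {W S : TopologicalSpace.Opens ℝ} (hWS : Disjoint W S)
      (hS : (0 : ℝ) ∈ closure (S : Set ℝ)) : (0 : ℝ) ∉ W := fun hW => by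
    obtain ⟨x, hxW, hxS⟩ := mem_closure_iff.mp hS W W.isOpen hW
    have hx : x ∈ W ⊓ S := ⟨hxW, hxS⟩
    rw [hWS.eq_bot] at hx
    exact hx
  refine ⟨U, fun h => ?_⟩
  have h0 : (0 : ℝ) ∈ Uᶜᶜ ⊔ Uᶜ := h ▸ TopologicalSpace.Opens.mem_top 0
  rcases h0 with h0 | h0
  · exact not_mem (disjoint_compl_left.mono_right hVU) (by simp [V]) h0
  · exact not_mem (S := U) disjoint_compl_left (by simp [U]) h0

theorem K_disj_distribution_fails : ∀ b : Bool, ∃ A B : Formula,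
    ¬ Deriv b ((K (A.or B)).imp ((K A).or (K B))) := by
  obtain ⟨U, hU⟩ := exists_opens_compl_compl_sup_compl_ne_top
  refine fun b => ⟨atom 0, (atom 0).neg, fun h => hU ?_⟩
  simpa [eval, Formula.neg] using h.eval_eq_top fun _ => U
end

section
/- Admissibility of the reflection rule: for L ∈ {IEL⁻, IEL} and every formula A, if L ⊢ K A then L ⊢ A. -/
open Formula

/-- The Kleene–Aczel slash for `Deriv b`, extended to `K` by letting `K A` be slashed
exactly when `A` is. -/
def Slash (b : Bool) : Formula → Prop
  | .atom n => Deriv b (.atom n)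
  | .bot => False
  | .and A B => Slash b A ∧ Slash b B
  | .or A B => Slash b A ∨ Slash b B
  | .imp A B => Deriv b (A.imp B) ∧ (Slash b A → Slash b B)
  | .K A => Slash b A

theorem Slash.deriv {b : Bool} {A : Formula} (h : Slash b A) : Deriv b A := by
  induction A with
  | atom n => exact h
  | bot => exact h.elim
  | and A B ihA ihB => exact .mp (.mp .a5 (ihA h.1)) (ihB h.2)
  | or A B ihA ihB => exact h.elim (fun h => .mp .a6 (ihA h)) (fun h => .mp .a7 (ihB h))
  | imp A B => exact h.1
  | K A ih => exact .mp .coref (ih h)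

theorem Deriv.slash {b : Bool} {A : Formula} (h : Deriv b A) : Slash b A := by
  induction h with
  | a1 => exact ⟨.a1, fun hA => ⟨.mp .a1 hA.deriv, fun _ => hA⟩⟩
  | a2 =>
    exact ⟨.a2, fun f => ⟨.mp .a2 f.1, fun g =>
      ⟨.mp (.mp .a2 f.1) g.1, fun hA => (f.2 hA).2 (g.2 hA)⟩⟩⟩
  | a3 => exact ⟨.a3, And.left⟩
  | a4 => exact ⟨.a4, And.right⟩
  | a5 => exact ⟨.a5, fun hA => ⟨.mp .a5 hA.deriv, fun hB => ⟨hA, hB⟩⟩⟩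
  | a6 => exact ⟨.a6, Or.inl⟩
  | a7 => exact ⟨.a7, Or.inr⟩
  | a8 =>
    exact ⟨.a8, fun f => ⟨.mp .a8 f.1, fun g =>
      ⟨.mp (.mp .a8 f.1) g.1, fun h => h.elim f.2 g.2⟩⟩⟩
  | a9 => exact ⟨.a9, False.elim⟩
  | dist =>
    exact ⟨.dist, fun f => ⟨.mp .dist (.mp .coref (Slash.deriv f)), fun hA => f.2 hA⟩⟩
  | coref => exact ⟨.coref, id⟩
  | ir => exact ⟨.ir, fun hA => ⟨.mp .ir (.mp .coref (Slash.deriv hA)), fun f => f.2 hA⟩⟩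
  | mp _ _ f hA => exact f.2 hA

theorem reflection_rule_admissible : ∀ (b : Bool) (A : Formula),
    Deriv b (K A) → Deriv b A := by
  intro b A h
  have hA : Slash b A := h.slash
  exact hA.deriv
end
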